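/- (Irreducible variance bound in the noiseless limit.) Let Y ~ Pois(μ), let g : ℤ_+^n → ℝ^n, and let D_φ be a Bregman divergence such that E[D_φ(Y, g(Y))²] < ∞ and E[⟨∇φ(g(Y)), Y⟩²] < ∞. Define Φ_g componentwise by Φ_{g,i}(y) = sup_{0 ≤ z ≤ y} |∇_iφ(g(z))| (inequalities componentwise over z ∈ ℤ_+^n), and assume E[⟨Φ_g(Y), Y⟩²] < ∞. For 0 < p < 1 let CB_p(g) be the coupled bootstrap estimator built from ω | Y ~ Binom(Y, p). Then limsup_{p → 0} Var( E[CB_p(g) | Y] ) ≤ 2·Var[ D_φ(Y, g(Y)) + ⟨∇φ(g(Y)), Y⟩ ] + 2·E[ ⟨Φ_g(Y), Y⟩² ]. -/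

import Mathlib

open MeasureTheory ProbabilityTheory Filter Set

noncomputable section

/-- Euclidean inner product on `ℝ^n`. -/
def dotR {n : ℕ} (u v : Fin n → ℝ) : ℝ := ∑ i, u i * v i

/-- Bregman divergence `D_φ(a,b) = φ(a) - φ(b) - ⟨∇φ(b), a - b⟩`, with gradient `φ'`. -/
def breg {n : ℕ} (φ : (Fin n → ℝ) → ℝ) (φ' : (Fin n → ℝ) → Fin n → ℝ)
    (a b : Fin n → ℝ) : ℝ :=
  φ a - φ b - dotR (φ' b) (fun i => a i - b i)

/-- Coercion of a nonnegative-integer vector to a real vector. -/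
def toR {n : ℕ} (y : Fin n → ℕ) : Fin n → ℝ := fun i => (y i : ℝ)

/-- `φ` is differentiable everywhere with gradient `φ'`. -/
def HasGrad {n : ℕ} (φ : (Fin n → ℝ) → ℝ) (φ' : (Fin n → ℝ) → Fin n → ℝ) : Prop :=
  ∀ x, HasFDerivAt φ (∑ i, φ' x i • (ContinuousLinearMap.proj i : (Fin n → ℝ) →L[ℝ] ℝ)) x

/-- Joint pmf of `n` independent Poisson coordinates with mean vector `ν`. -/
def poisPMF {n : ℕ} (ν : Fin n → ℝ) (y : Fin n → ℕ) : ℝ :=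
  ∏ i, Real.exp (-ν i) * ν i ^ y i / Nat.factorial (y i)

/-- `Y ~ Pois(ν)`: the coordinates of `Y` are independent Poissons with means `ν i`. -/
def HasPoissonLaw {Ω : Type*} [MeasurableSpace Ω] {n : ℕ} (P : Measure Ω)
    (ν : Fin n → ℝ) (Y : Ω → Fin n → ℕ) : Prop :=
  ∀ y, P {ω | Y ω = y} = ENNReal.ofReal (poisPMF ν y)

/-- Independence of two discrete random vectors, via factorization of the joint pmf. -/
def IndepDiscrete {Ω : Type*} [MeasurableSpace Ω] {n : ℕ} (P : Measure Ω)
    (Y Z : Ω → Fin n → ℕ) : Prop :=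
  ∀ y z, P {ω | Y ω = y ∧ Z ω = z} = P {ω | Y ω = y} * P {ω | Z ω = z}

/-- Binomial(m, p) pmf at `k`. -/
def binomPMF (m k : ℕ) (p : ℝ) : ℝ := (m.choose k : ℝ) * p ^ k * (1 - p) ^ (m - k)

/-- Joint pmf of independent binomials `ω_i ~ Binom(y_i, p)`. -/
def binomJointPMF {n : ℕ} (y : Fin n → ℕ) (p : ℝ) (w : Fin n → ℕ) : ℝ :=
  ∏ i, binomPMF (y i) (w i) p


/-- A single coupled-bootstrap summand `D_φ(Y†, g(Y*)) + φ(Y*) - φ(Y†)`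
for `Y* = y - w`, `Y† = ((1-p)/p) w`. -/
def cbTerm {n : ℕ} (φ : (Fin n → ℝ) → ℝ) (φ' : (Fin n → ℝ) → Fin n → ℝ)
    (g : (Fin n → ℕ) → Fin n → ℝ) (p : ℝ) (y w : Fin n → ℕ) : ℝ :=
  breg φ φ' (fun i => (1 - p) / p * (w i : ℝ)) (g (y - w)) +
    φ (toR (y - w)) - φ (fun i => (1 - p) / p * (w i : ℝ))

/-- Conditional mean `E[cbTerm | Y = y]` over `ω | Y = y ~ Binom(y, p)`. -/
def condMean {n : ℕ} (φ : (Fin n → ℝ) → ℝ) (φ' : (Fin n → ℝ) → Fin n → ℝ)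
    (g : (Fin n → ℕ) → Fin n → ℝ) (p : ℝ) (y : Fin n → ℕ) : ℝ :=
  ∑' w : Fin n → ℕ, binomJointPMF y p w * cbTerm φ φ' g p y w

/-- Conditional variance `Var[cbTerm | Y = y]` over `ω | Y = y ~ Binom(y, p)`. -/
def condVar {n : ℕ} (φ : (Fin n → ℝ) → ℝ) (φ' : (Fin n → ℝ) → Fin n → ℝ)
    (g : (Fin n → ℕ) → Fin n → ℝ) (p : ℝ) (y : Fin n → ℕ) : ℝ :=
  (∑' w : Fin n → ℕ, binomJointPMF y p w * (cbTerm φ φ' g p y w) ^ 2) -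
    (condMean φ φ' g p y) ^ 2

/-- `Φ_{g,i}(y) = sup_{0 ≤ z ≤ y} |∇_iφ(g(z))|`. -/
def PhiG {n : ℕ} (φ' : (Fin n → ℝ) → Fin n → ℝ) (g : (Fin n → ℕ) → Fin n → ℝ)
    (y : Fin n → ℕ) (i : Fin n) : ℝ :=
  ⨆ z : {z : Fin n → ℕ // ∀ j, z j ≤ y j}, |φ' (g z.1) i|

theorem poisPMF_nonneg {n : ℕ} {μ : Fin n → ℝ} (hμ : ∀ i, 0 ≤ μ i) (y : Fin n → ℕ) :
    0 ≤ poisPMF μ y :=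
  Finset.prod_nonneg fun i _ => by have := hμ i; positivity

theorem hasSum_poisPMF {n : ℕ} {μ : Fin n → ℝ} (hμ : ∀ i, 0 ≤ μ i) :
    HasSum (poisPMF μ) 1 := by
  let P : Measure (Fin n → ℕ) := Measure.pi fun i => poissonMeasure (μ i).toNNReal
  have hP : ∀ y, P {y} = ENNReal.ofReal (poisPMF μ y) := by
    intro y
    simp only [P, Measure.pi_singleton, poissonMeasure_singleton, poisPMF]
    rw [ENNReal.ofReal_prod_of_nonneg fun i _ => by have := hμ i; positivity]
    simp [Real.coe_toNNReal _ (hμ _)]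
  have h1 : ∑' y, ENNReal.ofReal (poisPMF μ y) = 1 := by
    have := Measure.tsum_indicator_apply_singleton P Set.univ MeasurableSet.univ
    simpa [hP] using this
  have hs : Summable (poisPMF μ) := by
    have := ENNReal.summable_toReal (f := fun y => ENNReal.ofReal (poisPMF μ y)) (by simp [h1])
    simpa [ENNReal.toReal_ofReal (poisPMF_nonneg hμ _)] using this
  rw [← ENNReal.ofReal_tsum_of_nonneg (poisPMF_nonneg hμ) hs] at h1
  rw [hs.hasSum_iff]
  simpa using h1

theorem binomPMF_nonneg (m k : ℕ) {p : ℝ} (hp : p ∈ Ioo (0 : ℝ) 1) : 0 ≤ binomPMF m k p := by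
  have h0 := hp.1.le
  have h1 : 0 ≤ 1 - p := by linarith [hp.2]
  unfold binomPMF; positivity

theorem sum_binomPMF (m : ℕ) (p : ℝ) : ∑ k ∈ Finset.range (m + 1), binomPMF m k p = 1 := by
  have := congrArg (Polynomial.eval p) (bernsteinPolynomial.sum ℝ m)
  simpa [Polynomial.eval_finsetSum, bernsteinPolynomial, binomPMF] using this

theorem sum_binomPMF_mul (m : ℕ) (p : ℝ) :
    ∑ k ∈ Finset.range (m + 1), binomPMF m k p * k = p * m := by
  have := congrArg (Polynomial.eval p) (bernsteinPolynomial.sum_smul ℝ m)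
  simp only [Polynomial.eval_finsetSum, bernsteinPolynomial, nsmul_eq_mul, Polynomial.eval_mul,
    Polynomial.eval_natCast, Polynomial.eval_pow, Polynomial.eval_sub, Polynomial.eval_one,
    Polynomial.eval_X] at this
  rw [mul_comm p, ← this]
  exact Finset.sum_congr rfl fun k _ => by unfold binomPMF; ring

/-- The finset of lattice points `0 ≤ w ≤ y`. -/
def box {n : ℕ} (y : Fin n → ℕ) : Finset (Fin n → ℕ) :=
  Fintype.piFinset fun i => Finset.range (y i + 1)

theorem mem_box {n : ℕ} {y w : Fin n → ℕ} : w ∈ box y ↔ w ≤ y := by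
  simp [box, Pi.le_def]

theorem binomJointPMF_nonneg {n : ℕ} (y w : Fin n → ℕ) {p : ℝ} (hp : p ∈ Ioo (0 : ℝ) 1) :
    0 ≤ binomJointPMF y p w :=
  Finset.prod_nonneg fun _ _ => binomPMF_nonneg _ _ hp

theorem sum_binomJointPMF {n : ℕ} (y : Fin n → ℕ) (p : ℝ) :
    ∑ w ∈ box y, binomJointPMF y p w = 1 := by
  unfold box binomJointPMF
  rw [← Finset.prod_univ_sum (fun i => Finset.range (y i + 1)) fun i k => binomPMF (y i) k p]
  simp [sum_binomPMF]

theorem sum_binomJointPMF_mul {n : ℕ} (y : Fin n → ℕ) (p : ℝ) (i : Fin n) :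
    ∑ w ∈ box y, binomJointPMF y p w * w i = p * y i := by
  have h : ∀ w : Fin n → ℕ, binomJointPMF y p w * w i =
      ∏ j, binomPMF (y j) (w j) p * (if j = i then (w j : ℝ) else 1) := by
    intro w
    rw [Finset.prod_mul_distrib]
    simp [binomJointPMF]
  simp_rw [h]
  unfold box
  rw [← Finset.prod_univ_sum (fun j => Finset.range (y j + 1))
    fun j k => binomPMF (y j) k p * (if j = i then (k : ℝ) else 1)]
  rw [Finset.prod_eq_single i]
  · simp [sum_binomPMF_mul]
  · intro j _ hj
    simp [hj, sum_binomPMF]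
  · simp

theorem binomJointPMF_eq_zero {n : ℕ} {y w : Fin n → ℕ} (p : ℝ) (hw : w ∉ box y) :
    binomJointPMF y p w = 0 := by
  rw [mem_box, Pi.le_def] at hw
  push Not at hw
  obtain ⟨i, hi⟩ := hw
  exact Finset.prod_eq_zero (Finset.mem_univ i) (by simp [binomPMF, Nat.choose_eq_zero_of_lt hi])

theorem condMean_eq_sum {n : ℕ} (φ : (Fin n → ℝ) → ℝ) (φ' : (Fin n → ℝ) → Fin n → ℝ)
    (g : (Fin n → ℕ) → Fin n → ℝ) (p : ℝ) (y : Fin n → ℕ) :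
    condMean φ φ' g p y = ∑ w ∈ box y, binomJointPMF y p w * cbTerm φ φ' g p y w :=
  tsum_eq_sum fun _ hw => by rw [binomJointPMF_eq_zero p hw, zero_mul]

/-- Poisson thinning, pointwise: a Poisson vector splits into independent Poisson vectors. -/
theorem poisPMF_mul_binomJointPMF {n : ℕ} (μ : Fin n → ℝ) (p : ℝ) {y w : Fin n → ℕ}
    (hw : w ≤ y) : poisPMF μ y * binomJointPMF y p w =
      poisPMF (fun i => (1 - p) * μ i) (y - w) * poisPMF (fun i => p * μ i) w := by
  simp only [poisPMF, binomJointPMF, binomPMF, ← Finset.prod_mul_distrib, Pi.sub_apply]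
  refine Finset.prod_congr rfl fun i _ => ?_
  obtain ⟨k, hk⟩ := Nat.exists_eq_add_of_le (hw i)
  rw [hk, Nat.add_sub_cancel_left, Nat.choose_symm_add, Nat.add_choose]
  rw [Nat.cast_div (Nat.factorial_mul_factorial_dvd_factorial_add _ _) (by positivity)]
  have he : Real.exp (-μ i) = Real.exp (-((1 - p) * μ i)) * Real.exp (-(p * μ i)) := by
    rw [← Real.exp_add]; congr 1; ring
  rw [he]
  push_cast
  field_simp
  rw [mul_pow, mul_pow]
  ring

theorem poisPMF_thinned_le {n : ℕ} {μ : Fin n → ℝ} (hμ : ∀ i, 0 ≤ μ i) {p : ℝ}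
    (hp : p ∈ Ioo (0 : ℝ) 1) (y : Fin n → ℕ) :
    poisPMF (fun i => (1 - p) * μ i) y ≤ Real.exp (p * ∑ i, μ i) * poisPMF μ y := by
  have h1 : 0 ≤ 1 - p := by linarith [hp.2]
  rw [Finset.mul_sum, Real.exp_sum, poisPMF, poisPMF, ← Finset.prod_mul_distrib]
  refine Finset.prod_le_prod (fun i _ => by have := hμ i; positivity) fun i _ => ?_
  have := hμ i
  rw [← mul_div_assoc, ← mul_assoc, ← Real.exp_add, mul_pow,
    show p * μ i + -μ i = -((1 - p) * μ i) by ring]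
  gcongr
  exact mul_le_of_le_one_left (by positivity) (pow_le_one₀ h1 (by linarith [hp.1]))

theorem thinning_sum_le {n : ℕ} {μ : Fin n → ℝ} (hμ : ∀ i, 0 ≤ μ i) {p : ℝ}
    (hp : p ∈ Ioo (0 : ℝ) 1) {G : (Fin n → ℕ) → ℝ} (hG : ∀ y, 0 ≤ G y)
    (hs : Summable fun y => poisPMF μ y * G y) :
    Summable (fun y => poisPMF μ y * ∑ w ∈ box y, binomJointPMF y p w * G (y - w)) ∧
    ∑' y, poisPMF μ y * ∑ w ∈ box y, binomJointPMF y p w * G (y - w) ≤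
      Real.exp (p * ∑ i, μ i) * ∑' y, poisPMF μ y * G y := by
  let A : Finset.HasAntidiagonal (Fin n → ℕ) :=
    { antidiagonal := fun y => (box y).image fun w => (y - w, w)
      mem_antidiagonal := by
        rintro y ⟨a, b⟩
        simp only [Finset.mem_image, mem_box, Prod.mk.injEq]
        constructor
        · rintro ⟨w, hw, rfl, rfl⟩
          exact tsub_add_cancel_of_le hw
        · rintro rfl
          exact ⟨b, le_add_self, add_tsub_cancel_right a b, rfl⟩ }
  have hq : ∀ i, 0 ≤ (1 - p) * μ i := fun i => mul_nonneg (by linarith [hp.2]) (hμ i)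
  have hr : ∀ i, 0 ≤ p * μ i := fun i => mul_nonneg hp.1.le (hμ i)
  set f : (Fin n → ℕ) → ℝ := fun y => poisPMF (fun i => (1 - p) * μ i) y * G y with hf
  set k : (Fin n → ℕ) → ℝ := poisPMF fun i => p * μ i with hk
  have hf0 : ∀ y, 0 ≤ f y := fun y => mul_nonneg (poisPMF_nonneg hq y) (hG y)
  have hfle : ∀ y, f y ≤ Real.exp (p * ∑ i, μ i) * (poisPMF μ y * G y) := fun y => by
    rw [← mul_assoc]
    exact mul_le_mul_of_nonneg_right (poisPMF_thinned_le hμ hp y) (hG y)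
  have hfs : Summable f := (hs.mul_left _).of_nonneg_of_le hf0 hfle
  have hks : HasSum k 1 := hasSum_poisPMF hr
  have hprod := hfs.mul_of_nonneg hks.summable hf0 (poisPMF_nonneg hr)
  have heq : ∀ y, ∑ kl ∈ A.antidiagonal y, f kl.1 * k kl.2 =
      poisPMF μ y * ∑ w ∈ box y, binomJointPMF y p w * G (y - w) := by
    intro y
    change ∑ kl ∈ (box y).image (fun w => (y - w, w)), f kl.1 * k kl.2 = _
    rw [Finset.sum_image fun a _ b _ h => congrArg Prod.snd h, Finset.mul_sum]
    refine Finset.sum_congr rfl fun w hw => ?_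
    rw [← mul_assoc, poisPMF_mul_binomJointPMF μ p (mem_box.1 hw)]
    simp only [hf, hk]
    ring
  have h1 := summable_sum_mul_antidiagonal_of_summable_mul hprod
  have h2 := hfs.tsum_mul_tsum_eq_tsum_sum_antidiagonal hks.summable hprod
  simp only [heq] at h1 h2
  refine ⟨h1, ?_⟩
  rw [← h2, hks.tsum_eq, mul_one, ← tsum_mul_left]
  exact hfs.tsum_le_tsum hfle (hs.mul_left _)

/-- The second moment of `X` about `c`, expanded, for `X` a function of a Poisson vector. -/
theorem hasSum_poisPMF_sub_sq {n : ℕ} {μ : Fin n → ℝ} (hμ : ∀ i, 0 ≤ μ i)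
    {X : (Fin n → ℕ) → ℝ} (h1 : Summable fun y => poisPMF μ y * X y)
    (h2 : Summable fun y => poisPMF μ y * X y ^ 2) (c : ℝ) :
    HasSum (fun y => poisPMF μ y * (X y - c) ^ 2)
      (∑' y, poisPMF μ y * X y ^ 2 - 2 * c * ∑' y, poisPMF μ y * X y + c ^ 2) := by
  have h := (h2.hasSum.sub (h1.hasSum.mul_left (2 * c))).add
    ((hasSum_poisPMF hμ).mul_left (c ^ 2))
  rw [mul_one] at h
  exact h.congr_fun fun y => by ring

theorem abs_le_PhiG {n : ℕ} (φ' : (Fin n → ℝ) → Fin n → ℝ) (g : (Fin n → ℕ) → Fin n → ℝ)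
    {y z : Fin n → ℕ} (hz : z ≤ y) (i : Fin n) : |φ' (g z) i| ≤ PhiG φ' g y i := by
  have hfin : Finite {z : Fin n → ℕ // ∀ j, z j ≤ y j} :=
    Finite.of_injective (β := box y) (fun z => ⟨z.1, mem_box.2 z.2⟩)
      fun a b h => Subtype.ext (congrArg (fun t => t.1) h)
  exact le_ciSup (f := fun z : {z : Fin n → ℕ // ∀ j, z j ≤ y j} => |φ' (g z.1) i|)
    (Set.finite_range _).bddAbove ⟨z, hz⟩

theorem cbTerm_eq {n : ℕ} (φ : (Fin n → ℝ) → ℝ) (φ' : (Fin n → ℝ) → Fin n → ℝ)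
    (g : (Fin n → ℕ) → Fin n → ℝ) (p : ℝ) (y w : Fin n → ℕ) :
    cbTerm φ φ' g p y w =
      (breg φ φ' (toR (y - w)) (g (y - w)) + dotR (φ' (g (y - w))) (toR (y - w))) -
        (1 - p) / p * ∑ i, φ' (g (y - w)) i * w i := by
  simp only [cbTerm, breg, dotR, mul_sub, Finset.sum_sub_distrib, Finset.mul_sum]
  have h : ∀ i, φ' (g (y - w)) i * ((1 - p) / p * (w i : ℝ)) =
      (1 - p) / p * (φ' (g (y - w)) i * (w i : ℝ)) := fun i => by ring
  simp only [h]
  ring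

theorem abs_sum_gradient_le {n : ℕ} (φ' : (Fin n → ℝ) → Fin n → ℝ)
    (g : (Fin n → ℕ) → Fin n → ℝ) {p : ℝ} (hp : p ∈ Ioo (0 : ℝ) 1) (y : Fin n → ℕ) :
    |∑ w ∈ box y, binomJointPMF y p w * ((1 - p) / p * ∑ i, φ' (g (y - w)) i * w i)| ≤
      ∑ i, PhiG φ' g y i * (y i : ℝ) := by
  have hp0 := hp.1
  have h1 : 0 ≤ 1 - p := by linarith [hp.2]
  have hΦ : ∀ i, 0 ≤ PhiG φ' g y i := fun i => (abs_nonneg _).trans (abs_le_PhiG φ' g le_rfl i)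
  calc _ ≤ ∑ w ∈ box y, |binomJointPMF y p w * ((1 - p) / p * ∑ i, φ' (g (y - w)) i * w i)| :=
        Finset.abs_sum_le_sum_abs _ _
    _ ≤ ∑ w ∈ box y, binomJointPMF y p w * ((1 - p) / p * ∑ i, PhiG φ' g y i * w i) := by
        refine Finset.sum_le_sum fun w _ => ?_
        rw [abs_mul, abs_mul, abs_of_nonneg (binomJointPMF_nonneg y w hp),
          abs_of_nonneg (show 0 ≤ (1 - p) / p by positivity)]
        refine mul_le_mul_of_nonneg_left (mul_le_mul_of_nonneg_left ?_ (by positivity))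
          (binomJointPMF_nonneg y w hp)
        refine (Finset.abs_sum_le_sum_abs _ _).trans (Finset.sum_le_sum fun i _ => ?_)
        rw [abs_mul, Nat.abs_cast]
        exact mul_le_mul_of_nonneg_right (abs_le_PhiG φ' g tsub_le_self i) (by positivity)
    _ = (1 - p) / p * ∑ i, PhiG φ' g y i * ∑ w ∈ box y, binomJointPMF y p w * w i := by
        simp only [Finset.mul_sum]
        rw [Finset.sum_comm]
        exact Finset.sum_congr rfl fun i _ => Finset.sum_congr rfl fun w _ => by ring
    _ = (1 - p) * ∑ i, PhiG φ' g y i * (y i : ℝ) := by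
        simp only [sum_binomJointPMF_mul, Finset.mul_sum]
        exact Finset.sum_congr rfl fun i _ => by field_simp
    _ ≤ _ := mul_le_of_le_one_left
        (Finset.sum_nonneg fun i _ => mul_nonneg (hΦ i) (by positivity)) (by linarith)

theorem condMean_sub_sq_le {n : ℕ} (φ : (Fin n → ℝ) → ℝ) (φ' : (Fin n → ℝ) → Fin n → ℝ)
    (g : (Fin n → ℕ) → Fin n → ℝ) {p : ℝ} (hp : p ∈ Ioo (0 : ℝ) 1) (c : ℝ) (y : Fin n → ℕ) :
    (condMean φ φ' g p y - c) ^ 2 ≤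
      2 * (∑ w ∈ box y, binomJointPMF y p w *
        (breg φ φ' (toR (y - w)) (g (y - w)) + dotR (φ' (g (y - w))) (toR (y - w)) - c) ^ 2) +
      2 * (∑ i, PhiG φ' g y i * (y i : ℝ)) ^ 2 := by
  set F : (Fin n → ℕ) → ℝ := fun z => breg φ φ' (toR z) (g z) + dotR (φ' (g z)) (toR z) with hF
  set a := ∑ w ∈ box y, binomJointPMF y p w * (F (y - w) - c) with ha
  set b := ∑ w ∈ box y, binomJointPMF y p w * ((1 - p) / p * ∑ i, φ' (g (y - w)) i * w i) with hb
  have hab : condMean φ φ' g p y - c = a - b := by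
    rw [condMean_eq_sum]
    simp only [cbTerm_eq, ha, hb, mul_sub, Finset.sum_sub_distrib, ← Finset.sum_mul,
      sum_binomJointPMF, hF]
    ring
  have h1 : a ^ 2 ≤ ∑ w ∈ box y, binomJointPMF y p w * (F (y - w) - c) ^ 2 := by
    have := (even_two.convexOn_pow (𝕜 := ℝ)).map_sum_le (t := box y) (w := binomJointPMF y p)
      (p := fun w => F (y - w) - c) (fun w _ => binomJointPMF_nonneg y w hp)
      (sum_binomJointPMF y p) (fun _ _ => Set.mem_univ _)
    simpa [smul_eq_mul] using this
  have h2 : b ^ 2 ≤ (∑ i, PhiG φ' g y i * (y i : ℝ)) ^ 2 :=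
    sq_le_sq' (abs_le.1 (abs_sum_gradient_le φ' g hp y)).1
      (abs_le.1 (abs_sum_gradient_le φ' g hp y)).2
  rw [hab]
  nlinarith [sq_nonneg (a + b)]

/-- irreducible variance bound in the noiseless limit:
`limsup_{p → 0} Var(E[CB_p(g) | Y]) ≤ 2 Var[D_φ(Y, g(Y)) + ⟨∇φ(g(Y)), Y⟩] + 2 E[⟨Φ_g(Y), Y⟩²]`. -/
theorem stmt19 {n : ℕ} (μ : Fin n → ℝ) (hμ : ∀ i, 0 ≤ μ i)
    (g : (Fin n → ℕ) → Fin n → ℝ)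
    (φ : (Fin n → ℝ) → ℝ) (φ' : (Fin n → ℝ) → Fin n → ℝ)
    (hconv : ConvexOn ℝ Set.univ φ) (hgrad : HasGrad φ φ')
    (hs1 : Summable (fun y : Fin n → ℕ => poisPMF μ y * (breg φ φ' (toR y) (g y)) ^ 2))
    (hs2 : Summable (fun y : Fin n → ℕ => poisPMF μ y * (dotR (φ' (g y)) (toR y)) ^ 2))
    (hs3 : Summable (fun y : Fin n → ℕ => poisPMF μ y *
      (breg φ φ' (toR y) (g y) + dotR (φ' (g y)) (toR y)) ^ 2))
    (hs4 : Summable (fun y : Fin n → ℕ => poisPMF μ y *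
      (breg φ φ' (toR y) (g y) + dotR (φ' (g y)) (toR y))))
    (hs5 : Summable (fun y : Fin n → ℕ => poisPMF μ y *
      (∑ i, PhiG φ' g y i * (y i : ℝ)) ^ 2))
    (hs6 : ∀ p ∈ Set.Ioo (0 : ℝ) 1,
      Summable (fun y : Fin n → ℕ => poisPMF μ y * (condMean φ φ' g p y) ^ 2))
    (hs7 : ∀ p ∈ Set.Ioo (0 : ℝ) 1,
      Summable (fun y : Fin n → ℕ => poisPMF μ y * condMean φ φ' g p y)) :
    Filter.limsup (fun p : ℝ =>
        (∑' y : Fin n → ℕ, poisPMF μ y * (condMean φ φ' g p y) ^ 2)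
          - (∑' y : Fin n → ℕ, poisPMF μ y * condMean φ φ' g p y) ^ 2)
      (nhdsWithin 0 (Set.Ioo 0 1))
      ≤ 2 * ((∑' y : Fin n → ℕ, poisPMF μ y *
              (breg φ φ' (toR y) (g y) + dotR (φ' (g y)) (toR y)) ^ 2)
            - (∑' y : Fin n → ℕ, poisPMF μ y *
                (breg φ φ' (toR y) (g y) + dotR (φ' (g y)) (toR y))) ^ 2)
        + 2 * ∑' y : Fin n → ℕ, poisPMF μ y * (∑ i, PhiG φ' g y i * (y i : ℝ)) ^ 2 := by
  set F : (Fin n → ℕ) → ℝ := fun y => breg φ φ' (toR y) (g y) + dotR (φ' (g y)) (toR y)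
  set m := ∑' y, poisPMF μ y * F y with hm
  set C := ∑' y, poisPMF μ y * (∑ i, PhiG φ' g y i * (y i : ℝ)) ^ 2
  have hF := hasSum_poisPMF_sub_sq hμ hs4 hs3 m
  have hvar : ∑' y, poisPMF μ y * (F y - m) ^ 2 = ∑' y, poisPMF μ y * F y ^ 2 - m ^ 2 := by
    rw [hF.tsum_eq]; ring
  have hne : (nhdsWithin (0 : ℝ) (Ioo 0 1)).NeBot := by
    rw [nhdsWithin_Ioo_eq_nhdsGT zero_lt_one]; infer_instance
  rw [← hvar]
  have hbound : ∀ p ∈ Ioo (0 : ℝ) 1,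
      (∑' y, poisPMF μ y * (condMean φ φ' g p y) ^ 2)
          - (∑' y, poisPMF μ y * condMean φ φ' g p y) ^ 2 ≤
        2 * (Real.exp (p * ∑ i, μ i) * ∑' y, poisPMF μ y * (F y - m) ^ 2) + 2 * C := by
    intro p hp
    have hX := hasSum_poisPMF_sub_sq hμ (hs7 p hp) (hs6 p hp) m
    obtain ⟨hts, htl⟩ := thinning_sum_le hμ hp (fun y => sq_nonneg (F y - m)) hF.summable
    calc _ ≤ ∑' y, poisPMF μ y * (condMean φ φ' g p y - m) ^ 2 := by
          rw [hX.tsum_eq]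
          nlinarith [sq_nonneg ((∑' y, poisPMF μ y * condMean φ φ' g p y) - m)]
      _ ≤ 2 * (∑' y, poisPMF μ y * ∑ w ∈ box y, binomJointPMF y p w * (F (y - w) - m) ^ 2)
            + 2 * C := by
          rw [← tsum_mul_left, ← tsum_mul_left,
            ← (hts.mul_left 2).tsum_add (hs5.mul_left 2)]
          refine hX.summable.tsum_le_tsum (fun y => ?_) ((hts.mul_left 2).add (hs5.mul_left 2))
          exact (mul_le_mul_of_nonneg_left (condMean_sub_sq_le φ φ' g hp m y)
            (poisPMF_nonneg hμ y)).trans_eq (by ring)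
      _ ≤ _ := by gcongr
  have hlim : Tendsto (fun p : ℝ => 2 * (Real.exp (p * ∑ i, μ i) *
      ∑' y, poisPMF μ y * (F y - m) ^ 2) + 2 * C) (nhdsWithin 0 (Ioo 0 1))
      (nhds (2 * (∑' y, poisPMF μ y * (F y - m) ^ 2) + 2 * C)) := by
    have hc : Continuous fun p : ℝ => 2 * (Real.exp (p * ∑ i, μ i) *
      ∑' y, poisPMF μ y * (F y - m) ^ 2) + 2 * C := by fun_prop
    simpa using (hc.tendsto 0).mono_left nhdsWithin_le_nhds
  rw [← hlim.limsup_eq]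
  refine limsup_le_limsup (eventually_mem_nhdsWithin.mono hbound) ?_ hlim.isBoundedUnder_le
  refine IsBoundedUnder.isCoboundedUnder_le ⟨0, ?_⟩
  refine eventually_map.2 (eventually_mem_nhdsWithin.mono fun p hp => ?_)
  have hX := hasSum_poisPMF_sub_sq hμ (hs7 p hp) (hs6 p hp)
    (∑' y, poisPMF μ y * condMean φ φ' g p y)
  have h0 := hX.nonneg fun y => mul_nonneg (poisPMF_nonneg hμ y) (sq_nonneg _)
  change (0 : ℝ) ≤ _
  linarith
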